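/- arXiv:2503.08554 — 2 statements merged into one kernel-verified Lean document; each statement's English description precedes it below -/
import Mathlib

section
/- The function L ↦ (2/L)·∫₀^{L/2} e^{−φ x²} dx is strictly decreasing on (0, ∞) for every fixed φ > 0; equivalently, L ↦ 1 − (√π/(L·√φ))·Φ(√φ·L/2) is strictly increasing on (0, ∞). Consequently, under the ultra-dense blockage model the high-SNR outage-probability gap between conventional and pinching antennas, γ₁·(1 − (√π/(D_L√φ))·Φ(√φ D_L/2)) with γ₁ > 0, is a strictly increasing function of D_L. -/
open Real MeasureTheory intervalIntegral Set

/-- The error function Φ(x) = (2/√π)·∫₀^x e^{−t²} dt. -/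
noncomputable def erf (x : ℝ) : ℝ :=
  (2 / Real.sqrt Real.pi) * ∫ t in (0:ℝ)..x, Real.exp (-t ^ 2)

theorem aux_anti (φ : ℝ) (hφ : 0 < φ) :
    StrictAntiOn (fun L : ℝ => ∫ u in (0:ℝ)..1, Real.exp (-φ * (L / 2 * u) ^ 2)) (Set.Ioi 0) := by
  intro a ha b hb hab
  simp only [Set.mem_Ioi] at ha hb
  have key : ∀ u : ℝ, 0 < u → Real.exp (-φ * (b / 2 * u) ^ 2) < Real.exp (-φ * (a / 2 * u) ^ 2) := by
    intro u hu
    apply Real.exp_lt_exp.mpr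
    have h1 : (a / 2 * u) ^ 2 < (b / 2 * u) ^ 2 := by gcongr
    nlinarith [mul_lt_mul_of_pos_left h1 hφ]
  apply intervalIntegral.integral_lt_integral_of_continuousOn_of_le_of_exists_lt one_pos
  · fun_prop
  · fun_prop
  · intro u hu
    exact (key u hu.1).le
  · exact ⟨1, by simp, key 1 one_pos⟩

theorem aux_eq1 (φ L : ℝ) (hL : 0 < L) :
    (2 / L) * ∫ x in (0:ℝ)..(L / 2), Real.exp (-φ * x ^ 2)
      = ∫ u in (0:ℝ)..1, Real.exp (-φ * (L / 2 * u) ^ 2) := by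
  have h := intervalIntegral.mul_integral_comp_mul_left (a := 0) (b := 1)
    (f := fun x : ℝ => Real.exp (-φ * x ^ 2)) (L / 2)
  simp only [mul_zero, mul_one] at h
  rw [← h]
  field_simp

theorem aux_eq2 (φ L : ℝ) (hφ : 0 < φ) (hL : 0 < L) :
    (Real.sqrt Real.pi / (L * Real.sqrt φ)) * erf (Real.sqrt φ * L / 2)
      = ∫ u in (0:ℝ)..1, Real.exp (-φ * (L / 2 * u) ^ 2) := by
  have h := intervalIntegral.mul_integral_comp_mul_left (a := 0) (b := 1)
    (f := fun x : ℝ => Real.exp (-x ^ 2)) (Real.sqrt φ * L / 2)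
  simp only [mul_zero, mul_one] at h
  have hs : 0 < Real.sqrt φ := Real.sqrt_pos.mpr hφ
  have hp : 0 < Real.sqrt Real.pi := Real.sqrt_pos.mpr Real.pi_pos
  have he : ∀ u : ℝ, -(Real.sqrt φ * L / 2 * u) ^ 2 = -φ * (L / 2 * u) ^ 2 := by
    intro u
    have := Real.sq_sqrt hφ.le
    calc _ = -(Real.sqrt φ) ^ 2 * (L / 2 * u) ^ 2 := by ring
      _ = _ := by rw [this]
  simp only [he] at h
  unfold erf
  rw [← h]
  generalize (∫ u in (0:ℝ)..1, Real.exp (-φ * (L / 2 * u) ^ 2)) = I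
  field_simp

/-- L ↦ (2/L)·∫₀^{L/2} e^{−φx²} dx is strictly decreasing on (0,∞);
equivalently L ↦ 1 − (√π/(L√φ))·Φ(√φ·L/2) is strictly increasing on (0,∞);
consequently the high-SNR outage gap γ₁·(1 − (√π/(D_L√φ))·Φ(√φ D_L/2)) with γ₁ > 0 is
strictly increasing in D_L. -/
theorem stmt_8 (φ : ℝ) (hφ : 0 < φ) :
    StrictAntiOn
      (fun L : ℝ => (2 / L) * ∫ x in (0:ℝ)..(L / 2), Real.exp (-φ * x ^ 2)) (Set.Ioi 0) ∧
    StrictMonoOn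
      (fun L : ℝ =>
        1 - (Real.sqrt Real.pi / (L * Real.sqrt φ)) * erf (Real.sqrt φ * L / 2))
      (Set.Ioi 0) ∧
    ∀ γ₁ : ℝ, 0 < γ₁ →
      StrictMonoOn
        (fun DL : ℝ =>
          γ₁ * (1 - (Real.sqrt Real.pi / (DL * Real.sqrt φ)) * erf (Real.sqrt φ * DL / 2)))
        (Set.Ioi 0) := by
  have h2 : StrictMonoOn
      (fun L : ℝ =>
        1 - (Real.sqrt Real.pi / (L * Real.sqrt φ)) * erf (Real.sqrt φ * L / 2))
      (Set.Ioi 0) := by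
    intro a ha b hb hab
    have := aux_anti φ hφ ha hb hab
    simp only [aux_eq2 φ a hφ ha, aux_eq2 φ b hφ hb] at this ⊢
    linarith
  refine ⟨?_, h2, ?_⟩
  · intro a ha b hb hab
    have := aux_anti φ hφ ha hb hab
    simp only [aux_eq1 φ a ha, aux_eq1 φ b hb] at this ⊢
    exact this
  · intro γ₁ hγ a ha b hb hab
    exact mul_lt_mul_of_pos_left (h2 ha hb hab) hγ
end

section
/- Let φ > 0, D_W > 0, d > 0 and τ₁ ≥ √(d² + D_W²/4). Then the exact single-user outage probability under the ultra-dense blockage model e^{−φ r²} equals 1 − (√π·e^{−φ d²}/(√φ·D_W))·Φ(√φ·D_W/2); that is, for Y uniform on [−D_W/2, D_W/2] and, conditionally on Y = y, α Bernoulli with P(α = 1 | Y = y) = e^{−φ·(y² + d²)}, one has P( α = 0 or √(Y² + d²) ≥ τ₁ ) = 1 − (√π·e^{−φ d²}/(√φ·D_W))·Φ(√φ·D_W/2), where Φ is the error function. -/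
open Real MeasureTheory intervalIntegral

lemma gauss_aux (φ DW d : ℝ) (hφ : 0 < φ) (hDW : 0 < DW) :
    (1 / DW) * ∫ y in (-(DW / 2))..(DW / 2), Real.exp (-φ * (y ^ 2 + d ^ 2)) =
      (Real.sqrt Real.pi * Real.exp (-φ * d ^ 2) / (Real.sqrt φ * DW)) *
          erf (Real.sqrt φ * DW / 2) := by
  have hs : 0 < Real.sqrt φ := Real.sqrt_pos.mpr hφ
  have hp : 0 < Real.sqrt Real.pi := Real.sqrt_pos.mpr Real.pi_pos
  have h1 : ∀ y : ℝ, Real.exp (-φ * (y ^ 2 + d ^ 2)) =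
      Real.exp (-φ * d ^ 2) * Real.exp (-(Real.sqrt φ * y) ^ 2) := by
    intro y
    rw [← Real.exp_add, mul_pow, Real.sq_sqrt hφ.le]
    ring_nf
  have hi : ∀ a b : ℝ, IntervalIntegrable (fun t : ℝ => Real.exp (-t ^ 2)) volume a b :=
    fun a b => Continuous.intervalIntegrable (by fun_prop) a b
  have h2 : ∫ t in (-(Real.sqrt φ * DW / 2))..(Real.sqrt φ * DW / 2), Real.exp (-t ^ 2) =
      2 * ∫ t in (0:ℝ)..(Real.sqrt φ * DW / 2), Real.exp (-t ^ 2) := by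
    rw [← intervalIntegral.integral_add_adjacent_intervals (hi _ 0) (hi 0 _)]
    have h3 := intervalIntegral.integral_comp_neg (a := 0) (b := Real.sqrt φ * DW / 2)
      (fun t : ℝ => Real.exp (-t ^ 2))
    simp only [neg_sq, neg_zero] at h3
    rw [← h3]; ring
  simp_rw [h1]
  rw [intervalIntegral.integral_const_mul,
    intervalIntegral.integral_comp_mul_left (fun t : ℝ => Real.exp (-t ^ 2)) hs.ne']
  have e1 : Real.sqrt φ * -(DW / 2) = -(Real.sqrt φ * DW / 2) := by ring
  have e2 : Real.sqrt φ * (DW / 2) = Real.sqrt φ * DW / 2 := by ring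
  rw [e1, e2, h2, erf, smul_eq_mul]
  field_simp

/-- at high SNR (τ₁ ≥ √(d² + D_W²/4)), the exact single-user outage
probability under the ultra-dense blockage model e^{−φr²} equals
1 − (√π·e^{−φd²}/(√φ·D_W))·Φ(√φ·D_W/2): here Y is uniform on [−D_W/2, D_W/2] and,
conditionally on Y = y, α is Bernoulli with P(α = 1 ∣ Y = y) = e^{−φ(y²+d²)}. -/
theorem stmt_15 {Ω : Type*} [MeasurableSpace Ω] (μ : Measure Ω) [IsProbabilityMeasure μ]
    (φ DW d τ₁ : ℝ) (hφ : 0 < φ) (hDW : 0 < DW) (hd : 0 < d)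
    (hτ₁ : Real.sqrt (d ^ 2 + DW ^ 2 / 4) ≤ τ₁)
    (Y : Ω → ℝ) (α : Ω → Bool) (hY : Measurable Y) (hα : Measurable α)
    (hlaw : Measure.map Y μ =
      (ENNReal.ofReal (1 / DW)) • volume.restrict (Set.Icc (-(DW / 2)) (DW / 2)))
    (hcond : ∀ B : Set ℝ, MeasurableSet B →
      μ {ω | α ω = true ∧ Y ω ∈ B} =
        ∫⁻ y in B, ENNReal.ofReal (Real.exp (-φ * (y ^ 2 + d ^ 2)))
          ∂((ENNReal.ofReal (1 / DW)) • volume.restrict (Set.Icc (-(DW / 2)) (DW / 2)))) :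
    μ {ω | α ω = false ∨ τ₁ ≤ Real.sqrt ((Y ω) ^ 2 + d ^ 2)} =
      ENNReal.ofReal
        (1 - (Real.sqrt Real.pi * Real.exp (-φ * d ^ 2) / (Real.sqrt φ * DW)) *
          erf (Real.sqrt φ * DW / 2)) := by
  set ν := (ENNReal.ofReal (1 / DW)) • volume.restrict (Set.Icc (-(DW / 2)) (DW / 2)) with hν
  have hA : MeasurableSet {ω | α ω = true} := hα (measurableSet_singleton true)
  have hle : -(DW / 2) ≤ DW / 2 := by linarith
  have hμA : μ {ω | α ω = true} = ENNReal.ofReal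
      ((Real.sqrt Real.pi * Real.exp (-φ * d ^ 2) / (Real.sqrt φ * DW)) *
          erf (Real.sqrt φ * DW / 2)) := by
    have h := hcond Set.univ MeasurableSet.univ
    simp only [Set.mem_univ, and_true] at h
    rw [h, Measure.restrict_univ, hν, lintegral_smul_measure, smul_eq_mul, ← gauss_aux φ DW d hφ hDW,
      ENNReal.ofReal_mul (by positivity), intervalIntegral.integral_of_le hle,
      ← integral_Icc_eq_integral_Ioc, ofReal_integral_eq_lintegral_ofReal]
    · exact (Continuous.continuousOn (by fun_prop)).integrableOn_Icc
    · exact Filter.Eventually.of_forall fun y => (Real.exp_pos _).le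
  have hae : ∀ᵐ ω ∂μ, Y ω ∈ Set.Ioo (-(DW / 2)) (DW / 2) := by
    have h : ∀ᵐ y ∂(Measure.map Y μ), y ∈ Set.Ioo (-(DW / 2)) (DW / 2) := by
      rw [hlaw]
      refine Measure.ae_smul_measure ?_ _
      rw [← Measure.restrict_congr_set (Ioo_ae_eq_Icc (μ := volume))]
      exact ae_restrict_mem measurableSet_Ioo
    exact ae_of_ae_map hY.aemeasurable h
  have hset : μ {ω | α ω = false ∨ τ₁ ≤ Real.sqrt ((Y ω) ^ 2 + d ^ 2)} =
      μ {ω | α ω = true}ᶜ := by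
    apply measure_congr
    filter_upwards [hae] with ω hω
    have hlt : Real.sqrt ((Y ω) ^ 2 + d ^ 2) < τ₁ := by
      refine lt_of_lt_of_le (Real.sqrt_lt_sqrt (by positivity) ?_) hτ₁
      nlinarith [hω.1, hω.2]
    apply propext
    change (α ω = false ∨ τ₁ ≤ Real.sqrt ((Y ω) ^ 2 + d ^ 2)) ↔ ¬ (α ω = true)
    simp [not_le.mpr hlt]
  have hnn : 0 ≤ (Real.sqrt Real.pi * Real.exp (-φ * d ^ 2) / (Real.sqrt φ * DW)) *
          erf (Real.sqrt φ * DW / 2) := by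
    rw [← gauss_aux φ DW d hφ hDW]
    exact mul_nonneg (by positivity)
      (intervalIntegral.integral_nonneg hle fun y _ => (Real.exp_pos _).le)
  rw [hset, prob_compl_eq_one_sub hA, hμA, ENNReal.ofReal_sub _ hnn, ENNReal.ofReal_one]
end
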